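/- Let n ≥ 3, let h : ℝⁿ₊ → ℝ₊ be a twice continuously differentiable function that is homogeneous of degree d ≠ 0, and let F : ℝ₊ → ℝ be twice continuously differentiable with F′ ≠ 0 everywhere. Then f = F ∘ h satisfies the homogeneous Monge–Ampère equation det(f_ij) = 0 at every point of ℝⁿ₊ if and only if either (1) there exists a constant β such that f − β is homogeneous of degree 1, or (2) there exist a twice continuously differentiable function φ : ℝ^{n−1}₊ → ℝ₊ satisfying det(φ_ij) = 0 at every point, and a twice continuously differentiable function G with G′ ≠ 0 everywhere, such that f(x₁,…,xₙ) = G( x₁ · φ(x₂/x₁, …, xₙ/x₁) ) on ℝⁿ₊. -/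

import Mathlib

open Real

/-- Partial derivative of `f` in the `i`-th coordinate direction. -/
noncomputable def pd {n : ℕ} (i : Fin n) (f : (Fin n → ℝ) → ℝ) (x : Fin n → ℝ) : ℝ :=
  fderiv ℝ f x (Pi.single i 1)

/-- Hessian matrix of second partial derivatives of `f` at `x`. -/
noncomputable def hess {n : ℕ} (f : (Fin n → ℝ) → ℝ) (x : Fin n → ℝ) :
    Matrix (Fin n) (Fin n) ℝ :=
  fun i j => pd i (pd j f) x

/-- Hessian determinant `det(f_ij)` of `f` at `x`. -/
noncomputable def hessDet {n : ℕ} (f : (Fin n → ℝ) → ℝ) (x : Fin n → ℝ) : ℝ :=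
  (hess f x).det

/-- The open positive orthant `ℝⁿ₊`. -/
def posOrth (n : ℕ) : Set (Fin n → ℝ) := {x | ∀ i, 0 < x i}


lemma isOpen_posOrth_aux (n : ℕ) : IsOpen (posOrth n) := by
  have : posOrth n = ⋂ i, {x : Fin n → ℝ | 0 < x i} := by
    ext x; simp [posOrth]
  rw [this]
  exact isOpen_iInter_of_finite fun i => isOpen_lt continuous_const (continuous_apply i)

lemma fderiv_eq_sum_pd {n : ℕ} (f : (Fin n → ℝ) → ℝ) (x v : Fin n → ℝ) :
    fderiv ℝ f x v = ∑ i, pd i f x * v i := by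
  have h := (fderiv ℝ f x).toLinearMap.pi_apply_eq_sum_univ v
  simp only [ContinuousLinearMap.coe_coe] at h
  rw [h]
  refine Finset.sum_congr rfl fun i _ => ?_
  rw [smul_eq_mul, mul_comm, pd]
  congr 2
  ext j
  simp [Pi.single_apply, eq_comm]

/-- projective coordinates -/
noncomputable def pj {m : ℕ} (x : Fin (m + 1) → ℝ) : Fin m → ℝ := fun i => x i.succ / x 0

/-- The matrix `x 0` times the Jacobian of `pj`. -/
noncomputable def ja {m : ℕ} (u : Fin m → ℝ) (k : Fin m) : Fin (m + 1) → ℝ :=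
  Fin.cons (-u k) (Pi.single k 1)

lemma pj_mem {m : ℕ} {x : Fin (m + 1) → ℝ} (hx : x ∈ posOrth (m + 1)) : pj x ∈ posOrth m :=
  fun i => div_pos (hx _) (hx _)

lemma hasFDerivAt_pj {m : ℕ} {x : Fin (m + 1) → ℝ} (hx : x 0 ≠ 0) :
    ∃ U : (Fin (m + 1) → ℝ) →L[ℝ] (Fin m → ℝ), HasFDerivAt pj U x ∧
      ∀ i k, U (Pi.single i 1) k = ja (pj x) k i / x 0 := by
  have hp : ∀ j : Fin (m + 1), HasFDerivAt (fun y : Fin (m + 1) → ℝ => y j)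
      (ContinuousLinearMap.proj (R := ℝ) (φ := fun _ : Fin (m + 1) => ℝ) j) x :=
    fun j => hasFDerivAt_apply j x
  have h1 : ∀ k : Fin m, HasFDerivAt (fun y : Fin (m + 1) → ℝ => y k.succ * (y 0)⁻¹) _ x :=
    fun k => (hp k.succ).mul ((hasDerivAt_inv hx).comp_hasFDerivAt x (hp 0))
  refine ⟨_, hasFDerivAt_pi.2 h1, ?_⟩
  intro i k
  simp only [ContinuousLinearMap.pi_apply]
  simp
  refine Fin.cases ?_ (fun i => ?_) i
  · simp [ja, pj]
    field_simp
  · simp [ja, Pi.single_apply]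
    split_ifs <;> simp_all

lemma comp_pj {m : ℕ} {x : Fin (m + 1) → ℝ} (hx : x 0 ≠ 0) (ψ : (Fin m → ℝ) → ℝ)
    (hψ : DifferentiableAt ℝ ψ (pj x)) :
    DifferentiableAt ℝ (fun y => ψ (pj y)) x ∧
    ∀ i, pd i (fun y => ψ (pj y)) x = (∑ l, pd l ψ (pj x) * ja (pj x) l i) / x 0 := by
  obtain ⟨U, hU, hU'⟩ := hasFDerivAt_pj hx
  have h := hψ.hasFDerivAt.comp x hU
  have h' : HasFDerivAt (fun y => ψ (pj y)) _ x := h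
  refine ⟨h'.differentiableAt, fun i => ?_⟩
  rw [pd, h'.fderiv, ContinuousLinearMap.comp_apply, fderiv_eq_sum_pd, Finset.sum_div]
  refine Finset.sum_congr rfl fun l _ => ?_
  rw [hU', mul_div_assoc]

lemma pd_mul {n : ℕ} {f g : (Fin n → ℝ) → ℝ} {x : Fin n → ℝ} (hf : DifferentiableAt ℝ f x)
    (hg : DifferentiableAt ℝ g x) (i : Fin n) :
    pd i (fun y => f y * g y) x = f x * pd i g x + pd i f x * g x := by
  have h : HasFDerivAt (fun y => f y * g y) _ x := hf.hasFDerivAt.mul hg.hasFDerivAt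
  rw [pd, h.fderiv]
  simp [pd]
  ring

lemma pd_scomp {n : ℕ} {G : ℝ → ℝ} {g : (Fin n → ℝ) → ℝ} {x : Fin n → ℝ}
    (hG : DifferentiableAt ℝ G (g x))
    (hg : DifferentiableAt ℝ g x) (i : Fin n) :
    pd i (fun y => G (g y)) x = deriv G (g x) * pd i g x := by
  have h : HasFDerivAt (fun y => G (g y)) _ x := hG.hasDerivAt.comp_hasFDerivAt x hg.hasFDerivAt
  rw [pd, h.fderiv]
  simp [pd]

lemma pd_congr {n : ℕ} {f g : (Fin n → ℝ) → ℝ} (hfg : ∀ y ∈ posOrth n, f y = g y)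
    (i : Fin n) {x : Fin n → ℝ} (hx : x ∈ posOrth n) : pd i f x = pd i g x := by
  have : f =ᶠ[nhds x] g := by
    filter_upwards [(isOpen_posOrth_aux n).mem_nhds hx] with y hy using hfg y hy
  rw [pd, pd, this.fderiv_eq]

lemma pd_coord {n : ℕ} (i j : Fin n) (x : Fin n → ℝ) :
    pd i (fun y => y j) x = if i = j then 1 else 0 := by
  have h : HasFDerivAt (fun y : Fin n → ℝ => y j)
      (ContinuousLinearMap.proj (R := ℝ) (φ := fun _ : Fin n => ℝ) j) x := hasFDerivAt_apply j x
  rw [pd, h.fderiv]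
  simp [Pi.single_apply, eq_comm]

lemma differentiableAt_pd {n : ℕ} {φ : (Fin n → ℝ) → ℝ} (hφ : ContDiffOn ℝ 2 φ (posOrth n))
    {u : Fin n → ℝ} (hu : u ∈ posOrth n) (k : Fin n) : DifferentiableAt ℝ (pd k φ) u := by
  have h1 : ContDiffOn ℝ 1 (fderiv ℝ φ) (posOrth n) :=
    hφ.fderiv_of_isOpen (isOpen_posOrth_aux n) (by norm_num)
  have h2 : DifferentiableAt ℝ (fderiv ℝ φ) u :=
    (h1.differentiableOn (by norm_num)).differentiableAt ((isOpen_posOrth_aux n).mem_nhds hu)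
  exact h2.clm_apply (differentiableAt_const _)

lemma differentiableAt_posOrth {n : ℕ} {φ : (Fin n → ℝ) → ℝ} (hφ : ContDiffOn ℝ 2 φ (posOrth n))
    {u : Fin n → ℝ} (hu : u ∈ posOrth n) : DifferentiableAt ℝ φ u :=
  (hφ.differentiableOn (by norm_num)).differentiableAt ((isOpen_posOrth_aux n).mem_nhds hu)

/-- gradient of `x 0 * φ (pj x)` -/
noncomputable def gr {m : ℕ} (φ : (Fin m → ℝ) → ℝ) (j : Fin (m + 1)) (x : Fin (m + 1) → ℝ) : ℝ :=
  (if j = 0 then φ (pj x) else 0) + ∑ k, pd k φ (pj x) * ja (pj x) k j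

lemma pd_persp {m : ℕ} {φ : (Fin m → ℝ) → ℝ} (hφ : ContDiffOn ℝ 2 φ (posOrth m))
    {x : Fin (m + 1) → ℝ} (hx : x ∈ posOrth (m + 1)) (j : Fin (m + 1)) :
    DifferentiableAt ℝ (fun y => y 0 * φ (pj y)) x ∧
    pd j (fun y => y 0 * φ (pj y)) x = gr φ j x := by
  have h0 : x 0 ≠ 0 := (hx 0).ne'
  obtain ⟨h1, h2⟩ := comp_pj h0 φ (differentiableAt_posOrth hφ (pj_mem hx))
  have h3 : DifferentiableAt ℝ (fun y : Fin (m + 1) → ℝ => y 0) x := by fun_prop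
  refine ⟨h3.mul h1, ?_⟩
  rw [pd_mul h3 h1, h2, pd_coord, gr]
  field_simp
  split_ifs <;> ring

lemma pd_gr {m : ℕ} {φ : (Fin m → ℝ) → ℝ} (hφ : ContDiffOn ℝ 2 φ (posOrth m))
    {x : Fin (m + 1) → ℝ} (hx : x ∈ posOrth (m + 1)) (i j : Fin (m + 1)) :
    DifferentiableAt ℝ (gr φ j) x ∧
    pd i (gr φ j) x =
      (∑ k, ∑ l, ja (pj x) l i * hess φ (pj x) l k * ja (pj x) k j) / x 0 := by
  have h0 : x 0 ≠ 0 := (hx 0).ne'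
  have hu := pj_mem hx
  have hk := fun k => comp_pj h0 (pd k φ) (differentiableAt_pd hφ hu k)
  refine Fin.cases ?_ (fun j => ?_) j
  · have e : gr φ 0 = fun y => φ (pj y) + ∑ k, pd k φ (pj y) * (-(pj y k)) := by
      ext y; simp [gr, ja]
    obtain ⟨h1, h2⟩ := comp_pj h0 φ (differentiableAt_posOrth hφ hu)
    have hc : ∀ k : Fin m, DifferentiableAt ℝ (fun y => -(pj y k)) x ∧
        pd i (fun y => -(pj y k)) x = - ja (pj x) k i / x 0 := by
      intro k
      have hd : DifferentiableAt ℝ (fun v : Fin m → ℝ => -(v k)) (pj x) := by fun_prop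
      obtain ⟨a, b⟩ := comp_pj h0 (fun v => - v k) hd
      refine ⟨a, ?_⟩
      rw [b]
      congr 1
      have : ∀ l, pd l (fun v : Fin m → ℝ => -(v k)) (pj x) = if l = k then -1 else 0 := by
        intro l
        have h : HasFDerivAt (fun y : Fin m → ℝ => -(y k))
          (-(ContinuousLinearMap.proj (R := ℝ) (φ := fun _ : Fin m => ℝ) k)) (pj x) :=
            (hasFDerivAt_apply k (pj x)).neg
        rw [pd, h.fderiv]
        simp [Pi.single_apply, eq_comm]
        split_ifs <;> simp
      simp [this]
    have hm : ∀ k : Fin m, DifferentiableAt ℝ (fun y => pd k φ (pj y) * (-(pj y k))) x :=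
      fun k => (hk k).1.mul (hc k).1
    rw [e]
    refine ⟨h1.add (DifferentiableAt.fun_sum fun k _ => hm k), ?_⟩
    have hs : HasFDerivAt (fun y => φ (pj y) + ∑ k, pd k φ (pj y) * (-(pj y k))) _ x :=
      h1.hasFDerivAt.add (HasFDerivAt.fun_sum fun k _ => (hm k).hasFDerivAt)
    have hs' : pd i (fun y => φ (pj y) + ∑ k, pd k φ (pj y) * (-(pj y k))) x =
        pd i (fun y => φ (pj y)) x + ∑ k, pd i (fun y => pd k φ (pj y) * (-(pj y k))) x := by
      rw [pd, hs.fderiv]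
      simp [pd]
    rw [hs', h2, Finset.sum_div, Finset.sum_div, ← Finset.sum_add_distrib]
    refine Finset.sum_congr rfl fun k _ => ?_
    rw [pd_mul (hk k).1 (hc k).1, (hc k).2, (hk k).2]
    have e2 : ∑ l, ja (pj x) l i * hess φ (pj x) l k * ja (pj x) k 0 =
       (∑ l, pd l (pd k φ) (pj x) * ja (pj x) l i) * (-(pj x k)) := by
      rw [Finset.sum_mul]
      refine Finset.sum_congr rfl fun l _ => ?_
      simp only [hess, ja, Fin.cons_zero]; ring
    rw [e2]; ring
  · have e : gr φ j.succ = fun y => pd j φ (pj y) := by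
      ext y; simp [gr, ja, Pi.single_apply]
    rw [e]
    refine ⟨(hk j).1, ?_⟩
    rw [(hk j).2]
    congr 1
    rw [Finset.sum_comm]
    refine Finset.sum_congr rfl fun l _ => ?_
    simp [ja, Pi.single_apply, hess]
    ring

lemma hess_persp {m : ℕ} {φ : (Fin m → ℝ) → ℝ} (hφ : ContDiffOn ℝ 2 φ (posOrth m))
    (hφ0 : ∀ u ∈ posOrth m, 0 < φ u) {G : ℝ → ℝ} (hG : ContDiffOn ℝ 2 G (Set.Ioi 0))
    {f : (Fin (m + 1) → ℝ) → ℝ} (hf : ∀ y ∈ posOrth (m + 1), f y = G (y 0 * φ (pj y)))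
    {x : Fin (m + 1) → ℝ} (hx : x ∈ posOrth (m + 1)) (i j : Fin (m + 1)) :
    hess f x i j = deriv (deriv G) (x 0 * φ (pj x)) * gr φ i x * gr φ j x +
      deriv G (x 0 * φ (pj x)) *
      ((∑ k, ∑ l, ja (pj x) l i * hess φ (pj x) l k * ja (pj x) k j) / x 0) := by
  have hp : ∀ y ∈ posOrth (m + 1), 0 < y 0 * φ (pj y) := fun y hy =>
    mul_pos (hy 0) (hφ0 _ (pj_mem hy))
  have hG1 : ∀ s : ℝ, 0 < s → DifferentiableAt ℝ G s := fun s hs =>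
    (hG.differentiableOn (by norm_num)).differentiableAt (isOpen_Ioi.mem_nhds hs)
  have hG2 : ∀ s : ℝ, 0 < s → DifferentiableAt ℝ (deriv G) s := fun s hs =>
    ((hG.deriv_of_isOpen (m := 1) isOpen_Ioi (by norm_num)).differentiableOn
      (by norm_num)).differentiableAt (isOpen_Ioi.mem_nhds hs)
  have e1 : ∀ y ∈ posOrth (m + 1), pd j f y = deriv G (y 0 * φ (pj y)) * gr φ j y := by
    intro y hy
    rw [pd_congr hf j hy, pd_scomp (g := fun y => y 0 * φ (pj y)) (hG1 _ (hp y hy))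
      (pd_persp hφ hy j).1, (pd_persp hφ hy j).2]
  obtain ⟨d1, p1⟩ := pd_persp hφ hx i
  obtain ⟨d2, p2⟩ := pd_gr hφ hx i j
  have d3 : DifferentiableAt ℝ (fun y => deriv G (y 0 * φ (pj y))) x :=
    DifferentiableAt.comp x (g := deriv G) (hG2 _ (hp x hx)) d1
  rw [hess, pd_congr e1 i hx, pd_mul d3 d2, p2,
    pd_scomp (g := fun y => y 0 * φ (pj y)) (hG2 _ (hp x hx)) d1, p1]
  ring

lemma det_alg {m : ℕ} (a b p : ℝ) (u q : Fin m → ℝ) (A : Matrix (Fin m) (Fin m) ℝ)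
    (r : Fin (m + 1) → ℝ)
    (hr : ∀ j, r j = (if j = 0 then p else 0) + ∑ k, q k * ja u k j) :
    (Matrix.of fun i j : Fin (m + 1) => a * r i * r j + b *
      (∑ k, ∑ l, ja u l i * A l k * ja u k j)).det = a * p ^ 2 * b ^ m * A.det := by
  let Q : Matrix (Fin (m + 1)) (Fin (m + 1)) ℝ := Matrix.of (Fin.cons r (fun k => ja u k))
  let D : Matrix (Fin (m + 1)) (Fin (m + 1)) ℝ :=
    Matrix.of (Fin.cons (Fin.cons a 0) (fun k => Fin.cons 0 (fun l => b * A k l)))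
  have h1 : (Matrix.of fun i j : Fin (m + 1) => a * r i * r j + b *
      (∑ k, ∑ l, ja u l i * A l k * ja u k j)) = Q.transpose * D * Q := by
    ext i j
    simp only [Matrix.mul_apply, Fin.sum_univ_succ, Matrix.of_apply, Matrix.transpose_apply, Q, D,
      Fin.cons_zero, Fin.cons_succ, Pi.zero_apply, mul_zero, add_zero, zero_add,
      Finset.sum_const_zero]
    simp only [Finset.mul_sum, Finset.sum_mul]
    congr 1
    · ring
    · exact Finset.sum_congr rfl fun k _ => Finset.sum_congr rfl fun l _ => by ring
  have hD : D.det = a * (b ^ m * A.det) := by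
    rw [Matrix.det_succ_row_zero, Fin.sum_univ_succ]
    have : D.submatrix Fin.succ Fin.succ = b • A := by
      ext k l; simp [D]
    simp [Fin.succAbove_zero, this, Matrix.det_smul]
    simp [D]
  have hQ : Q.det = p := by
    -- subtract from row zero the combination of the others
    have hQ1 : Q.det = (Matrix.of (Fin.cons (Fin.cons p 0) (fun k => ja u k)) :
        Matrix (Fin (m + 1)) (Fin (m + 1)) ℝ).det := by
      have e : Q = (Matrix.of (Fin.cons (Fin.cons 1 q) (fun k => Fin.cons 0 (Pi.single k 1))) :
        Matrix (Fin (m + 1)) (Fin (m + 1)) ℝ) * (Matrix.of (Fin.cons (Fin.cons p 0) (fun k => ja u k)) :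
        Matrix (Fin (m + 1)) (Fin (m + 1)) ℝ) := by
        ext i j
        refine Fin.cases ?_ (fun i => ?_) i
        · simp only [Q, Matrix.mul_apply, Fin.sum_univ_succ, Matrix.of_apply, Fin.cons_zero,
            Fin.cons_succ, hr j]
          congr 1
          refine Fin.cases ?_ (fun j => ?_) j <;> simp
        · simp [Q, Matrix.mul_apply, Fin.sum_univ_succ, Pi.single_apply]
      rw [e, Matrix.det_mul, Matrix.det_of_upperTriangular, Fin.prod_univ_succ]
      · simp
      · intro i j hij
        revert hij
        refine Fin.cases ?_ (fun i => ?_) i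
        · simp
        · refine Fin.cases ?_ (fun j => ?_) j
          · simp
          · intro hij
            have : j < i := by simpa using hij
            simp [Pi.single_apply, this.ne]
    rw [hQ1, Matrix.det_of_lowerTriangular, Fin.prod_univ_succ]
    · simp [ja]
    · intro i j hij
      revert hij
      refine Fin.cases ?_ (fun i => ?_) i <;> refine Fin.cases ?_ (fun j => ?_) j
      · simp
      · simp
      · intro hij
        exact absurd (OrderDual.toDual_lt_toDual.1 hij) (by simp)
      · intro hij
        have : i < j := by simpa using hij
        simp [ja, Pi.single_apply, this.ne']
  rw [h1, Matrix.det_mul, Matrix.det_mul, Matrix.det_transpose, hQ, hD]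
  ring

lemma hessDet_persp {m : ℕ} {φ : (Fin m → ℝ) → ℝ} (hφ : ContDiffOn ℝ 2 φ (posOrth m))
    (hφ0 : ∀ u ∈ posOrth m, 0 < φ u) {G : ℝ → ℝ} (hG : ContDiffOn ℝ 2 G (Set.Ioi 0))
    {f : (Fin (m + 1) → ℝ) → ℝ} (hf : ∀ y ∈ posOrth (m + 1), f y = G (y 0 * φ (pj y)))
    {x : Fin (m + 1) → ℝ} (hx : x ∈ posOrth (m + 1)) :
    hessDet f x = deriv (deriv G) (x 0 * φ (pj x)) * φ (pj x) ^ 2 *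
      (deriv G (x 0 * φ (pj x)) / x 0) ^ m * hessDet φ (pj x) := by
  rw [hessDet, hessDet, ← det_alg _ _ _ (pj x) (fun k => pd k φ (pj x)) (hess φ (pj x))
    (fun j => gr φ j x) (fun j => rfl)]
  congr 1
  ext i j
  rw [hess_persp hφ hφ0 hG hf hx, Matrix.of_apply]
  ring

lemma smul_cons_aux {m : ℕ} {u : Fin m → ℝ} (hu : u ∈ posOrth m) {s : ℝ} (hs : 0 < s) :
    s • (Fin.cons 1 u : Fin (m + 1) → ℝ) ∈ posOrth (m + 1) ∧
    pj (s • (Fin.cons 1 u : Fin (m + 1) → ℝ)) = u ∧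
    (s • (Fin.cons 1 u : Fin (m + 1) → ℝ)) 0 = s := by
  refine ⟨fun i => ?_, ?_, by simp⟩
  · refine Fin.cases ?_ (fun i => ?_) i
    · simpa using hs
    · simpa using mul_pos hs (hu i)
  · ext i
    simp [pj]
    field_simp

/-- For `n = m + 1 ≥ 3`, a C² function `h : ℝⁿ₊ → ℝ₊` homogeneous of degree
`d ≠ 0`, and a C² function `F : ℝ₊ → ℝ` with `F′ ≠ 0` everywhere, `f = F ∘ h` satisfies
`det(f_ij) = 0` on `ℝⁿ₊` iff either (1) `f − β` is homogeneous of degree 1 for some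
constant `β`, or (2) `f(x₁,…,xₙ) = G(x₁·φ(x₂/x₁,…,xₙ/x₁))` for some C² function
`φ : ℝ^{n−1}₊ → ℝ₊` with `det(φ_ij) = 0` everywhere and some C² function `G` with
`G′ ≠ 0` everywhere. -/
theorem stmt_3 {m : ℕ} (hm : 3 ≤ m + 1) (d : ℝ) (hd0 : d ≠ 0)
    (h : (Fin (m + 1) → ℝ) → ℝ)
    (hC2 : ContDiffOn ℝ 2 h (posOrth (m + 1)))
    (hpos : ∀ x ∈ posOrth (m + 1), 0 < h x)
    (hhom : ∀ t : ℝ, 0 < t → ∀ x ∈ posOrth (m + 1), h (t • x) = t ^ d * h x)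
    (F : ℝ → ℝ) (hFC2 : ContDiffOn ℝ 2 F (Set.Ioi (0 : ℝ)))
    (hF' : ∀ u : ℝ, 0 < u → deriv F u ≠ 0) :
    (∀ x ∈ posOrth (m + 1), hessDet (fun y => F (h y)) x = 0) ↔
      ((∃ β : ℝ, ∀ t : ℝ, 0 < t → ∀ x ∈ posOrth (m + 1),
          F (h (t • x)) - β = t * (F (h x) - β)) ∨
       (∃ φ : (Fin m → ℝ) → ℝ,
          ContDiffOn ℝ 2 φ (posOrth m) ∧ (∀ u ∈ posOrth m, 0 < φ u) ∧
          (∀ u ∈ posOrth m, hessDet φ u = 0) ∧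
          ∃ G : ℝ → ℝ, ContDiffOn ℝ 2 G (Set.Ioi (0 : ℝ)) ∧
            (∀ u : ℝ, 0 < u → deriv G u ≠ 0) ∧
            ∀ x ∈ posOrth (m + 1),
              F (h x) = G (x 0 * φ (fun i => x i.succ / x 0)))) := by
  have hone : (fun _ => 1 : Fin m → ℝ) ∈ posOrth m := fun _ => one_pos
  obtain ⟨H, hH⟩ : ∃ H : ℝ → ℝ, H = fun s => F (s ^ d) := ⟨_, rfl⟩
  obtain ⟨φ, hφd⟩ : ∃ φ : (Fin m → ℝ) → ℝ, φ = fun u => h (Fin.cons 1 u) ^ (1 / d) := ⟨_, rfl⟩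
  have hcons : ∀ u ∈ posOrth m, (Fin.cons 1 u : Fin (m + 1) → ℝ) ∈ posOrth (m + 1) := by
    intro u hu
    simpa using (smul_cons_aux hu one_pos).1
  have hφ0 : ∀ u ∈ posOrth m, 0 < φ u := by
    intro u hu
    rw [hφd]
    exact Real.rpow_pos_of_pos (hpos _ (hcons u hu)) _
  have hφ : ContDiffOn ℝ 2 φ (posOrth m) := by
    have hc : ContDiff ℝ 2 (fun u : Fin m → ℝ => (Fin.cons 1 u : Fin (m + 1) → ℝ)) := by
      rw [contDiff_pi]
      intro i
      refine Fin.cases ?_ (fun i => ?_) i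
      · simpa using contDiff_const
      · simpa using contDiff_apply ℝ ℝ i
    rw [hφd]
    exact (hC2.comp hc.contDiffOn hcons).rpow_const_of_ne
      (fun u hu => (hpos _ (hcons u hu)).ne')
  have hHC : ContDiffOn ℝ 2 H (Set.Ioi (0 : ℝ)) := by
    rw [hH]
    exact hFC2.comp (contDiffOn_id.rpow_const_of_ne (fun u hu => (ne_of_gt hu)))
      (fun s hs => Real.rpow_pos_of_pos hs _)
  have hH1 : ∀ s : ℝ, 0 < s → DifferentiableAt ℝ H s := fun s hs =>
    (hHC.differentiableOn (by norm_num)).differentiableAt (isOpen_Ioi.mem_nhds hs)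
  have hH2 : ∀ s : ℝ, 0 < s → DifferentiableAt ℝ (deriv H) s := fun s hs =>
    ((hHC.deriv_of_isOpen (m := 1) isOpen_Ioi (by norm_num)).differentiableOn
      (by norm_num)).differentiableAt (isOpen_Ioi.mem_nhds hs)
  have hH' : ∀ s : ℝ, 0 < s → deriv H s ≠ 0 := by
    intro s hs
    have hsd := Real.rpow_pos_of_pos hs d
    have hFd : DifferentiableAt ℝ F (s ^ d) :=
      (hFC2.differentiableOn (by norm_num)).differentiableAt (isOpen_Ioi.mem_nhds hsd)
    have h1 : HasDerivAt H (deriv F (s ^ d) * (d * s ^ (d - 1))) s := by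
      rw [hH]
      exact hFd.hasDerivAt.comp s (Real.hasDerivAt_rpow_const (Or.inl hs.ne'))
    rw [h1.deriv]
    exact mul_ne_zero (hF' _ hsd) (mul_ne_zero hd0 (Real.rpow_pos_of_pos hs _).ne')
  have hf : ∀ y ∈ posOrth (m + 1), F (h y) = H (y 0 * φ (pj y)) := by
    intro y hy
    have hy0 := hy 0
    have e : y = y 0 • (Fin.cons 1 (pj y) : Fin (m + 1) → ℝ) := by
      ext i
      refine Fin.cases ?_ (fun i => ?_) i
      · simp
      · simp [pj]
        field_simp
    have hq := hpos _ (hcons _ (pj_mem hy))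
    have e2 : h y = (y 0) ^ d * h (Fin.cons 1 (pj y)) := by
      conv_lhs => rw [e]
      exact hhom _ hy0 _ (hcons _ (pj_mem hy))
    rw [e2, hH, hφd]
    simp only
    rw [Real.mul_rpow hy0.le (Real.rpow_nonneg hq.le _), ← Real.rpow_mul hq.le,
      one_div_mul_cancel hd0, Real.rpow_one]
  have hfs : ∀ t : ℝ, 0 < t → ∀ x ∈ posOrth (m + 1), F (h (t • x)) = H (t * (x 0 * φ (pj x))) := by
    intro t ht x hx
    have hx' : t • x ∈ posOrth (m + 1) := fun i => by simpa using mul_pos ht (hx i)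
    have e : pj (t • x) = pj x := by
      ext i
      simp only [pj, Pi.smul_apply, smul_eq_mul]
      exact mul_div_mul_left _ _ ht.ne'
    rw [hf _ hx', e]
    simp [mul_assoc]
  have key := fun x hx => hessDet_persp hφ hφ0 hHC hf (x := x) hx
  constructor
  · intro hdet
    by_cases hz : ∀ u ∈ posOrth m, hessDet φ u = 0
    · exact Or.inr ⟨φ, hφ, hφ0, hz, H, hHC, hH', hf⟩
    · left
      push Not at hz
      obtain ⟨u, hu, hne⟩ := hz
      have hdd : ∀ s ∈ Set.Ioi (0 : ℝ), deriv (deriv H) s = 0 := by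
        intro s hs
        have hs : 0 < s := hs
        have hp := hφ0 u hu
        obtain ⟨hx, e1, e2⟩ := smul_cons_aux hu (div_pos hs hp)
        have hk := key _ hx
        rw [hdet _ hx, e1, e2, div_mul_cancel₀ _ hp.ne'] at hk
        have hA : (deriv H s / (s / φ u)) ^ m ≠ 0 :=
          pow_ne_zero _ (div_ne_zero (hH' s hs) (div_pos hs hp).ne')
        by_contra hc
        exact (mul_ne_zero (mul_ne_zero (mul_ne_zero hc (pow_ne_zero 2 hp.ne')) hA) hne) hk.symm
      have hd1 : ∀ s ∈ Set.Ioi (0 : ℝ), deriv H s = deriv H 1 := by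
        intro s hs
        exact isOpen_Ioi.is_const_of_deriv_eq_zero isPreconnected_Ioi
          (fun s hs => (hH2 s hs).differentiableWithinAt) hdd hs (Set.mem_Ioi.2 one_pos)
      have hlin : ∀ s ∈ Set.Ioi (0 : ℝ), H s = (H 1 - deriv H 1) + deriv H 1 * s := by
        intro s hs
        have hder : ∀ s ∈ Set.Ioi (0 : ℝ), HasDerivAt (fun s => H s - deriv H 1 * s) 0 s := by
          intro s hs
          have := (hH1 s hs).hasDerivAt.fun_sub ((hasDerivAt_id' s).const_mul (deriv H 1))
          rw [hd1 s hs, mul_one, sub_self] at this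
          exact this
        have := isOpen_Ioi.is_const_of_deriv_eq_zero isPreconnected_Ioi
          (fun s hs => (hder s hs).differentiableAt.differentiableWithinAt)
          (fun s hs => (hder s hs).deriv) hs (Set.mem_Ioi.2 one_pos)
        simp only [mul_one] at this
        linarith
      refine ⟨H 1 - deriv H 1, fun t ht x hx => ?_⟩
      have hp := mul_pos (hx 0) (hφ0 _ (pj_mem hx))
      rw [hfs t ht x hx, hf x hx, hlin _ (mul_pos ht hp), hlin _ hp]
      ring
  · rintro (⟨β, hβ⟩ | ⟨ψ, hψ, hψ0, hz, G, hG, -, hfG⟩) x hx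
    · have hlin : ∀ s ∈ Set.Ioi (0 : ℝ), H s = β + (H 1 - β) * s := by
        intro s hs
        have hp := hφ0 _ hone
        obtain ⟨hx, e1, e2⟩ := smul_cons_aux hone (inv_pos.2 hp)
        have := hβ s hs _ hx
        rw [hfs s hs _ hx, hf _ hx, e1, e2, inv_mul_cancel₀ hp.ne', mul_one] at this
        linarith
      have hd1 : ∀ s ∈ Set.Ioi (0 : ℝ), deriv H s = H 1 - β := by
        intro s hs
        have e : H =ᶠ[nhds s] fun s => β + (H 1 - β) * s := by
          filter_upwards [isOpen_Ioi.mem_nhds hs] with y hy using hlin y hy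
        rw [e.deriv_eq]
        have := ((hasDerivAt_id s).const_mul (H 1 - β)).const_add β
        simpa using this.deriv
      have hp := mul_pos (hx 0) (hφ0 _ (pj_mem hx))
      have e : deriv H =ᶠ[nhds (x 0 * φ (pj x))] fun _ => H 1 - β := by
        filter_upwards [isOpen_Ioi.mem_nhds hp] with y hy using hd1 y hy
      rw [key x hx, e.deriv_eq]
      simp
    · rw [hessDet_persp hψ hψ0 hG hfG hx, hz _ (pj_mem hx), mul_zero]
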